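/- arXiv:2302.13414 — 5 statements merged into one kernel-verified Lean document; each statement's English description precedes it below -/
import Mathlib

section
/- If p is an optimal deviation vector, then p^{δ,Δ}_{ℓ,u,w} is also an optimal deviation vector, where Δ := min_{s∈S} w(s)·p(s) and δ := max_{s∈S} w(s)·p(s) − Δ. -/
open Finset

noncomputable section

variable {S : Type*}

/-- Sum of a real-valued function over a finite subset: `f(X) = ∑_{s∈X} f(s)`. -/
def costSum (c : S → ℝ) (X : Finset S) : ℝ := ∑ s ∈ X, c s

/-- The weighted span `spa_w(p) = max_{s∈S} w(s)p(s) − min_{s∈S} w(s)p(s)`. -/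
def spa [Fintype S] [Nonempty S] (w p : S → ℝ) : ℝ :=
  (univ.sup' univ_nonempty fun s => w s * p s) -
    (univ.inf' univ_nonempty fun s => w s * p s)

/-- A deviation vector `p` is feasible if `F*` has minimum `(c−p)`-cost in `𝓕`
and `ℓ ≤ p ≤ u` pointwise. -/
def IsFeasible (𝓕 : Finset (Finset S)) (Fstar : Finset S) (c : S → ℝ)
    (ℓ u : S → EReal) (p : S → ℝ) : Prop :=
  (∀ F ∈ 𝓕, costSum (fun s => c s - p s) Fstar ≤ costSum (fun s => c s - p s) F) ∧
    (∀ s, ℓ s ≤ (p s : EReal)) ∧ (∀ s, (p s : EReal) ≤ u s)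

/-- A feasible deviation vector is optimal if it minimizes the weighted span. -/
def IsOptimal [Fintype S] [Nonempty S] (𝓕 : Finset (Finset S)) (Fstar : Finset S)
    (c : S → ℝ) (ℓ u : S → EReal) (w : S → ℝ) (p : S → ℝ) : Prop :=
  IsFeasible 𝓕 Fstar c ℓ u p ∧
    ∀ q, IsFeasible 𝓕 Fstar c ℓ u q → spa w p ≤ spa w q

/-- The special deviation vector `p^{δ,Δ}_{ℓ,u,w}`: the value `(δ+Δ)/w(s)` on `F*`
and `Δ/w(s)` outside `F*`, truncated to `[ℓ(s), u(s)]`. -/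
def pdd [DecidableEq S] (Fstar : Finset S) (w : S → ℝ) (ℓ u : S → EReal)
    (δ Δ : ℝ) (s : S) : ℝ :=
  let v : ℝ := if s ∈ Fstar then (δ + Δ) / w s else Δ / w s
  if (v : EReal) < ℓ s then (ℓ s).toReal
  else if (u s : EReal) < (v : EReal) then (u s).toReal
  else v

/-- Sums of a function that is nonnegative on `A` and nonpositive off `A` are largest on `A`. -/
theorem sum_le_sum_of_nonneg_of_nonpos [DecidableEq S] {A : Finset S} {d : S → ℝ}
    (hA : ∀ s ∈ A, 0 ≤ d s) (hA' : ∀ s ∉ A, d s ≤ 0) (F : Finset S) :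
    ∑ s ∈ F, d s ≤ ∑ s ∈ A, d s := by
  rw [← sum_inter_add_sum_sdiff F A, ← sum_inter_add_sum_sdiff A F, inter_comm A F]
  exact add_le_add_right ((sum_nonpos fun s hs => hA' s (mem_sdiff.mp hs).2).trans
    (sum_nonneg fun s hs => hA s (mem_sdiff.mp hs).1)) _

/-- Raising the deviation on `Fstar` and lowering it elsewhere, within the bounds, keeps a
deviation vector feasible. -/
theorem IsFeasible.of_le_of_ge [DecidableEq S] {𝓕 : Finset (Finset S)} {Fstar : Finset S}
    {c : S → ℝ} {ℓ u : S → EReal} {p q : S → ℝ} (hp : IsFeasible 𝓕 Fstar c ℓ u p)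
    (hge : ∀ s ∈ Fstar, p s ≤ q s) (hle : ∀ s ∉ Fstar, q s ≤ p s)
    (hℓ : ∀ s, ℓ s ≤ (q s : EReal)) (hu : ∀ s, (q s : EReal) ≤ u s) :
    IsFeasible 𝓕 Fstar c ℓ u q := by
  refine ⟨fun F hF => ?_, hℓ, hu⟩
  have h := hp.1 F hF
  have hd := sum_le_sum_of_nonneg_of_nonpos (d := fun s => q s - p s)
    (fun s hs => sub_nonneg.mpr (hge s hs)) (fun s hs => sub_nonpos.mpr (hle s hs)) F
  simp only [costSum, sum_sub_distrib] at h hd ⊢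
  linarith

/-- The weighted span is at most the length of any interval containing the weighted values. -/
theorem spa_le_of_forall_mem_Icc [Fintype S] [Nonempty S] {w q : S → ℝ} {m M : ℝ}
    (h : ∀ s, w s * q s ∈ Set.Icc m M) : spa w q ≤ M - m :=
  sub_le_sub (sup'_le _ _ fun s _ => (h s).2) (le_inf' _ _ fun s _ => (h s).1)

/-- `pdd` respects the bounds `ℓ` and `u`. -/
theorem pdd_mem_Icc [DecidableEq S] (Fstar : Finset S) (w : S → ℝ) {ℓ u : S → EReal} (δ Δ : ℝ)
    {s : S} (hl : ℓ s ≠ ⊤) (hu : u s ≠ ⊥) (hlu : ℓ s ≤ u s) :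
    (pdd Fstar w ℓ u δ Δ s : EReal) ∈ Set.Icc (ℓ s) (u s) := by
  unfold pdd
  extract_lets v
  split_ifs with h₁ h₂
  · rw [EReal.coe_toReal hl (ne_bot_of_gt h₁)]
    exact ⟨le_rfl, hlu⟩
  · rw [EReal.coe_toReal (ne_top_of_lt h₂) hu]
    exact ⟨hlu, le_rfl⟩
  · exact ⟨not_lt.mp h₁, not_lt.mp h₂⟩

/-- On `Fstar`, `pdd` lies between any smaller admissible value and the untruncated value. -/
theorem pdd_mem_Icc_of_mem [DecidableEq S] {Fstar : Finset S} {w : S → ℝ} {ℓ u : S → EReal}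
    {δ Δ : ℝ} {s : S} (hs : s ∈ Fstar) {x : ℝ} (hu : u s ≠ ⊥) (hℓx : ℓ s ≤ x) (hxu : x ≤ u s)
    (hx : x ≤ (δ + Δ) / w s) : pdd Fstar w ℓ u δ Δ s ∈ Set.Icc x ((δ + Δ) / w s) := by
  simp only [pdd, if_pos hs]
  rw [if_neg (not_lt.mpr (hℓx.trans (EReal.coe_le_coe_iff.mpr hx)))]
  split_ifs with h
  · have hcoe := EReal.coe_toReal (ne_top_of_lt h) hu
    rw [← hcoe] at h hxu
    exact ⟨EReal.coe_le_coe_iff.mp hxu, (EReal.coe_lt_coe_iff.mp h).le⟩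
  · exact ⟨hx, le_rfl⟩

/-- Off `Fstar`, `pdd` lies between the untruncated value and any larger admissible value. -/
theorem pdd_mem_Icc_of_notMem [DecidableEq S] {Fstar : Finset S} {w : S → ℝ} {ℓ u : S → EReal}
    {δ Δ : ℝ} {s : S} (hs : s ∉ Fstar) {x : ℝ} (hl : ℓ s ≠ ⊤) (hℓx : ℓ s ≤ x) (hxu : x ≤ u s)
    (hx : Δ / w s ≤ x) : pdd Fstar w ℓ u δ Δ s ∈ Set.Icc (Δ / w s) x := by
  simp only [pdd, if_neg hs]
  rw [if_neg (not_lt.mpr ((EReal.coe_le_coe_iff.mpr hx).trans hxu))]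
  split_ifs with h
  · have hcoe := EReal.coe_toReal hl (ne_bot_of_gt h)
    rw [← hcoe] at h hℓx
    exact ⟨(EReal.coe_lt_coe_iff.mp h).le, EReal.coe_le_coe_iff.mp hℓx⟩
  · exact ⟨le_rfl, hx⟩

/-- If `p` is an optimal deviation vector, then `p^{δ,Δ}_{ℓ,u,w}` is also optimal, where
`Δ = min_{s∈S} w(s)p(s)` and `δ = max_{s∈S} w(s)p(s) − Δ`. -/
theorem stmt0 [Fintype S] [DecidableEq S] [Nonempty S]
    (𝓕 : Finset (Finset S)) (Fstar : Finset S) (hFstar : Fstar ∈ 𝓕)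
    (c w : S → ℝ) (hw : ∀ s, 0 < w s)
    (ℓ u : S → EReal) (hl : ∀ s, ℓ s ≠ ⊤) (hu : ∀ s, u s ≠ ⊥)
    (hlu : ∀ s, ℓ s ≤ u s)
    (p : S → ℝ) (hp : IsOptimal 𝓕 Fstar c ℓ u w p)
    (Δ δ : ℝ)
    (hΔ : Δ = univ.inf' univ_nonempty fun s => w s * p s)
    (hδ : δ = (univ.sup' univ_nonempty fun s => w s * p s) - Δ) :
    IsOptimal 𝓕 Fstar c ℓ u w (pdd Fstar w ℓ u δ Δ) := by
  have hm : ∀ s, Δ ≤ w s * p s := fun s =>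
    hΔ ▸ inf'_le (fun s => w s * p s) (mem_univ s)
  have hM : ∀ s, w s * p s ≤ δ + Δ := fun s => by
    rw [hδ, sub_add_cancel]
    exact le_sup' (fun s => w s * p s) (mem_univ s)
  have hspa : spa w p = δ + Δ - Δ := by rw [spa, ← hΔ, ← hδ, add_sub_cancel_right]
  have hin : ∀ s ∈ Fstar, pdd Fstar w ℓ u δ Δ s ∈ Set.Icc (p s) ((δ + Δ) / w s) := fun s hs =>
    pdd_mem_Icc_of_mem hs (hu s) (hp.1.2.1 s) (hp.1.2.2 s) ((le_div_iff₀' (hw s)).mpr (hM s))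
  have hout : ∀ s ∉ Fstar, pdd Fstar w ℓ u δ Δ s ∈ Set.Icc (Δ / w s) (p s) := fun s hs =>
    pdd_mem_Icc_of_notMem hs (hl s) (hp.1.2.1 s) (hp.1.2.2 s) ((div_le_iff₀' (hw s)).mpr (hm s))
  have hbd := fun s => pdd_mem_Icc Fstar w δ Δ (hl s) (hu s) (hlu s)
  refine ⟨hp.1.of_le_of_ge (fun s hs => (hin s hs).1) (fun s hs => (hout s hs).2)
    (fun s => (hbd s).1) (fun s => (hbd s).2), fun q hq => le_trans ?_ (hp.2 q hq)⟩
  rw [hspa]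
  refine spa_le_of_forall_mem_Icc fun s => ?_
  by_cases hs : s ∈ Fstar
  · exact ⟨(hm s).trans (mul_le_mul_of_nonneg_left (hin s hs).1 (hw s).le),
      (le_div_iff₀' (hw s)).mp (hin s hs).2⟩
  · exact ⟨(div_le_iff₀' (hw s)).mp (hout s hs).1,
      (mul_le_mul_of_nonneg_left (hout s hs).2 (hw s).le).trans (hM s)⟩
end
end

section
/- If a feasible deviation vector exists, then there exist δ, Δ ∈ ℝ such that p^{δ,Δ}_{ℓ,u,w} is an optimal deviation vector with min_{s∈S} w(s)·p^{δ,Δ}_{ℓ,u,w}(s) = Δ and max_{s∈S} w(s)·p^{δ,Δ}_{ℓ,u,w}(s) = δ + Δ; moreover Δ ≤ w(s)·u(s) and δ + Δ ≥ w(s)·ℓ(s) for every s ∈ S (inequalities in ℝ ∪ {±∞}). -/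
open Finset

noncomputable section

variable {S : Type*}

lemma costSum_sub (f g : S → ℝ) (X : Finset S) :
    costSum (fun s => f s - g s) X = costSum f X - costSum g X :=
  Finset.sum_sub_distrib f g

lemma costSum_add_div (q w : S → ℝ) (t : ℝ) (X : Finset S) :
    costSum (fun s => q s + t / w s) X = costSum q X + t * costSum (fun s => 1 / w s) X := by
  simp only [costSum, Finset.sum_add_distrib, Finset.mul_sum, mul_one_div]

lemma costSum_le_mul {w q : S → ℝ} (hw : ∀ s, 0 < w s) {B : ℝ} (h : ∀ s, w s * q s ≤ B)
    (X : Finset S) : costSum q X ≤ B * costSum (fun s => 1 / w s) X := by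
  simp only [costSum, Finset.mul_sum, mul_one_div]
  exact Finset.sum_le_sum fun s _ => (le_div_iff₀' (hw s)).2 (h s)

lemma mul_le_costSum {w q : S → ℝ} (hw : ∀ s, 0 < w s) {B : ℝ} (h : ∀ s, B ≤ w s * q s)
    (X : Finset S) : B * costSum (fun s => 1 / w s) X ≤ costSum q X := by
  simp only [costSum, Finset.mul_sum, mul_one_div]
  exact Finset.sum_le_sum fun s _ => (div_le_iff₀' (hw s)).2 (h s)

lemma costSum_sdiff_sub_sdiff [DecidableEq S] (f : S → ℝ) (X Y : Finset S) :
    costSum f (X \ Y) - costSum f (Y \ X) = costSum f X - costSum f Y := by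
  have h₁ : costSum f (X \ Y) + costSum f (X ∩ Y) = costSum f X := by
    rw [add_comm]; exact Finset.sum_inter_add_sum_sdiff X Y f
  have h₂ : costSum f (Y \ X) + costSum f (Y ∩ X) = costSum f Y := by
    rw [add_comm]; exact Finset.sum_inter_add_sum_sdiff Y X f
  rw [Finset.inter_comm] at h₂
  linarith

/-- Increasing a deviation vector on `F*` and decreasing it off `F*` keeps `F*` optimal. -/
lemma costSum_le_of_monotone [DecidableEq S] {Fstar F : Finset S} {c p q : S → ℝ}
    (hin : ∀ s ∈ Fstar, q s ≤ p s) (hout : ∀ s ∉ Fstar, p s ≤ q s)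
    (hq : costSum (fun s => c s - q s) Fstar ≤ costSum (fun s => c s - q s) F) :
    costSum (fun s => c s - p s) Fstar ≤ costSum (fun s => c s - p s) F := by
  simp only [costSum_sub] at *
  have hp := costSum_sdiff_sub_sdiff p Fstar F
  have hq' := costSum_sdiff_sub_sdiff q Fstar F
  have h₁ : costSum q (Fstar \ F) ≤ costSum p (Fstar \ F) :=
    Finset.sum_le_sum fun s hs => hin s (Finset.mem_sdiff.1 hs).1
  have h₂ : costSum p (F \ Fstar) ≤ costSum q (F \ Fstar) :=
    Finset.sum_le_sum fun s hs => hout s (Finset.mem_sdiff.1 hs).2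
  linarith

lemma spa_le [Fintype S] [Nonempty S] {w p : S → ℝ} {a b : ℝ}
    (ha : ∀ s, a ≤ w s * p s) (hb : ∀ s, w s * p s ≤ b) : spa w p ≤ b - a :=
  sub_le_sub (Finset.sup'_le _ _ fun s _ => hb s) (Finset.le_inf' _ _ fun s _ => ha s)

lemma continuous_spa [Fintype S] [Nonempty S] (w : S → ℝ) : Continuous (spa w) := by
  unfold spa
  refine Continuous.sub ?_ ?_
  · exact Continuous.finset_sup'_apply _ fun s _ => by fun_prop
  · exact Continuous.finset_inf'_apply _ fun s _ => by fun_prop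

lemma isClosed_setOf_isFeasible (𝓕 : Finset (Finset S)) (Fstar : Finset S) (c : S → ℝ)
    (ℓ u : S → EReal) : IsClosed {p | IsFeasible 𝓕 Fstar c ℓ u p} := by
  have hcont (s : S) : Continuous fun p : S → ℝ => (p s : EReal) :=
    continuous_coe_real_ereal.comp (continuous_apply s)
  have hsum (X : Finset S) : Continuous fun p : S → ℝ => costSum (fun s => c s - p s) X := by
    unfold costSum; fun_prop
  simp only [IsFeasible, Set.ofPred_and, Set.ofPred_forall]
  refine IsClosed.inter ?_ (IsClosed.inter ?_ ?_)
  · exact isClosed_iInter fun F => isClosed_iInter fun _ => isClosed_le (hsum _) (hsum _)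
  · exact isClosed_iInter fun s => isClosed_le continuous_const (hcont s)
  · exact isClosed_iInter fun s => isClosed_le (hcont s) continuous_const

lemma truncation_bounds {w q v : ℝ} (hw : 0 < w) {a b : ℝ} (ha : a ≤ w * q) (hb : w * q ≤ b)
    {l u : EReal} (hl : l ≤ q) (hu : (q : EReal) ≤ u) {x : ℝ} (hv : v = x / w)
    (hax : a ≤ x) (hxb : x ≤ b) (p : ℝ)
    (hp : p = if (v : EReal) < l then l.toReal else if u < (v : EReal) then u.toReal else v) :
    l ≤ p ∧ (p : EReal) ≤ u ∧ a ≤ w * p ∧ w * p ≤ b ∧ (b ≤ x → q ≤ p) ∧ (x ≤ a → p ≤ q) := by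
  have hwv : w * v = x := by rw [hv]; field_simp
  have hcancel {y z : ℝ} (h : w * y ≤ w * z) : y ≤ z := le_of_mul_le_mul_left h hw
  split_ifs at hp with h₁ h₂
  · have hcoe : (l.toReal : EReal) = l :=
      EReal.coe_toReal (hl.trans_lt (EReal.coe_lt_top q)).ne ((EReal.bot_lt_coe v).trans h₁).ne'
    rw [← hp] at hcoe
    rw [← hcoe] at h₁ hl
    have h₃ : v < p := EReal.coe_lt_coe_iff.1 h₁
    have h₄ : p ≤ q := EReal.coe_le_coe_iff.1 hl
    have h₅ := mul_le_mul_of_nonneg_left h₃.le hw.le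
    have h₆ := mul_le_mul_of_nonneg_left h₄ hw.le
    exact ⟨hcoe.ge, hl.trans hu, by linarith, by linarith, fun h => hcancel (by linarith),
      fun _ => h₄⟩
  · have hcoe : (u.toReal : EReal) = u :=
      EReal.coe_toReal (h₂.trans (EReal.coe_lt_top v)).ne ((EReal.bot_lt_coe q).trans_le hu).ne'
    rw [← hp] at hcoe
    rw [← hcoe] at h₂ hu
    have h₃ : p < v := EReal.coe_lt_coe_iff.1 h₂
    have h₄ : q ≤ p := EReal.coe_le_coe_iff.1 hu
    have h₅ := mul_le_mul_of_nonneg_left h₃.le hw.le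
    have h₆ := mul_le_mul_of_nonneg_left h₄ hw.le
    exact ⟨hl.trans hu, hcoe.le, by linarith, by linarith, fun _ => h₄,
      fun h => hcancel (by linarith)⟩
  · subst hp
    exact ⟨not_lt.1 h₁, not_lt.1 h₂, by linarith, by linarith, fun h => hcancel (by linarith),
      fun h => hcancel (by linarith)⟩

lemma exists_shift_threshold [Fintype S] (𝓕 : Finset (Finset S)) (Fstar : Finset S)
    (c w : S → ℝ) (ℓ u : S → EReal) (D : ℝ) :
    ∃ M : ℝ, 0 ≤ M ∧ (∀ s, w s * (u s).toReal ≤ M ∧ w s * (ℓ s).toReal ≤ M ∧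
        -M ≤ w s * (u s).toReal ∧ -M ≤ w s * (ℓ s).toReal) ∧
      ∀ F ∈ 𝓕,
        costSum (fun s => 1 / w s) Fstar - costSum (fun s => 1 / w s) F ≠ 0 →
        costSum c Fstar - costSum c F +
            D * (costSum (fun s => 1 / w s) Fstar + costSum (fun s => 1 / w s) F) ≤
          M * |costSum (fun s => 1 / w s) Fstar - costSum (fun s => 1 / w s) F| := by
  refine Filter.Eventually.exists (f := Filter.atTop) ?_
  refine (Filter.eventually_ge_atTop 0).and (Filter.Eventually.and ?_ ?_)
  · refine Filter.eventually_all.2 fun s => ?_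
    filter_upwards [Filter.eventually_ge_atTop |w s * (u s).toReal|,
      Filter.eventually_ge_atTop |w s * (ℓ s).toReal|] with M h₁ h₂
    exact ⟨(abs_le.1 h₁).2, (abs_le.1 h₂).2, (abs_le.1 h₁).1, (abs_le.1 h₂).1⟩
  · refine (Filter.eventually_all_finset 𝓕).2 fun F _ => ?_
    by_cases h : costSum (fun s => 1 / w s) Fstar - costSum (fun s => 1 / w s) F = 0
    · exact Filter.Eventually.of_forall fun _ h' => absurd h h'
    · have := Filter.tendsto_id.atTop_mul_const (r := |costSum (fun s => 1 / w s) Fstar -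
        costSum (fun s => 1 / w s) F|) (abs_pos.2 h)
      filter_upwards [this.eventually_ge_atTop _] with M hM _
      exact hM

/-- Feasible deviation vectors of bounded span can be shifted into a fixed box. -/
lemma exists_isFeasible_bounded [Fintype S] [Nonempty S]
    (𝓕 : Finset (Finset S)) (Fstar : Finset S)
    (c w : S → ℝ) (hw : ∀ s, 0 < w s) (ℓ u : S → EReal) (hl : ∀ s, ℓ s ≠ ⊤) (hu : ∀ s, u s ≠ ⊥)
    (D : ℝ) : ∃ M : ℝ, ∀ q, IsFeasible 𝓕 Fstar c ℓ u q → spa w q ≤ D →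
      ∃ q', IsFeasible 𝓕 Fstar c ℓ u q' ∧ (∀ s, |w s * q' s| ≤ M) ∧ spa w q' ≤ spa w q := by
  obtain ⟨M, hM0, hM, hMF⟩ := exists_shift_threshold 𝓕 Fstar c w ℓ u D
  refine ⟨M + D, fun q hq hD => ?_⟩
  set R : Finset S → ℝ := costSum fun s => 1 / w s
  set a := univ.inf' univ_nonempty fun s => w s * q s
  set b := univ.sup' univ_nonempty fun s => w s * q s
  have hspa : spa w q = b - a := rfl
  have haq (s : S) : a ≤ w s * q s := Finset.inf'_le _ (Finset.mem_univ s)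
  have hqb (s : S) : w s * q s ≤ b := Finset.le_sup' (fun s => w s * q s) (Finset.mem_univ s)
  have hR0 (X : Finset S) : 0 ≤ R X :=
    Finset.sum_nonneg fun s _ => (one_div_pos.2 (hw s)).le
  have hmul (t : ℝ) (s : S) : w s * (q s + t / w s) = w s * q s + t := by
    have := (hw s).ne'; field_simp
  have hcancel (s : S) {y z : ℝ} (h : w s * y ≤ w s * z) : y ≤ z :=
    le_of_mul_le_mul_left h (hw s)
  rcases lt_or_ge M a with hMa | haM
  · have hbd (s : S) : M ≤ w s * (q s + (M - a) / w s) ∧ w s * (q s + (M - a) / w s) ≤ M + D := by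
      rw [hmul]; constructor <;> linarith [haq s, hqb s]
    refine ⟨fun s => q s + (M - a) / w s, ⟨fun F hF => ?_, fun s => ?_, fun s => ?_⟩,
      fun s => abs_le.2 ⟨by linarith [(hbd s).1, (hbd s).2], (hbd s).2⟩, ?_⟩
    · have h := hq.1 F hF
      rw [costSum_sub, costSum_sub] at h
      rw [costSum_sub, costSum_sub]
      rcases le_or_gt (R Fstar - R F) 0 with hb0 | hb0
      · rw [costSum_add_div, costSum_add_div]
        change _ - (_ + _ * R _) ≤ _ - (_ + _ * R _)
        nlinarith
      · have h₁ := mul_le_costSum hw (fun s => (hbd s).1) Fstar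
        have h₂ := costSum_le_mul hw (fun s => (hbd s).2) F
        have h₃ := hMF F hF hb0.ne'
        rw [abs_of_pos hb0] at h₃
        change _ * R _ ≤ _ at h₁
        change _ ≤ _ * R _ at h₂
        nlinarith [hR0 Fstar, hR0 F, mul_nonneg (show 0 ≤ D by
          obtain ⟨s⟩ := ‹Nonempty S›; linarith [haq s, hqb s]) (hR0 Fstar)]
    · induction h : ℓ s with
      | bot => exact bot_le
      | top => exact absurd h (hl s)
      | coe r =>
        have h' := (hM s).2.1
        rw [h, EReal.toReal_coe] at h'
        exact EReal.coe_le_coe_iff.2 (hcancel s (h'.trans (hbd s).1))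
    · induction h : u s with
      | bot => exact absurd h (hu s)
      | top => exact le_top
      | coe r =>
        have h' := (hM s).1
        have h'' := hq.2.2 s
        rw [h] at h' h''
        have := mul_le_mul_of_nonneg_left (EReal.coe_le_coe_iff.1 h'') (hw s).le
        rw [EReal.toReal_coe] at h'
        linarith [haq s]
    · rw [hspa]
      refine (spa_le (a := M) (b := b + (M - a)) (fun s => (hbd s).1) fun s => ?_).trans
        (by linarith)
      rw [hmul]; linarith [hqb s]
  rcases lt_or_ge b (-M) with hbM | hMb
  · have hbd (s : S) : -M - D ≤ w s * (q s + (-M - b) / w s) ∧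
        w s * (q s + (-M - b) / w s) ≤ -M := by
      rw [hmul]; constructor <;> linarith [haq s, hqb s]
    refine ⟨fun s => q s + (-M - b) / w s, ⟨fun F hF => ?_, fun s => ?_, fun s => ?_⟩,
      fun s => abs_le.2 ⟨by linarith [(hbd s).1], by linarith [(hbd s).1, (hbd s).2]⟩, ?_⟩
    · have h := hq.1 F hF
      rw [costSum_sub, costSum_sub] at h
      rw [costSum_sub, costSum_sub]
      rcases le_or_gt 0 (R Fstar - R F) with hb0 | hb0
      · rw [costSum_add_div, costSum_add_div]
        change _ - (_ + _ * R _) ≤ _ - (_ + _ * R _)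
        nlinarith
      · have h₁ := mul_le_costSum hw (fun s => (hbd s).1) Fstar
        have h₂ := costSum_le_mul hw (fun s => (hbd s).2) F
        have h₃ := hMF F hF hb0.ne
        rw [abs_of_neg hb0] at h₃
        change _ * R _ ≤ _ at h₁
        change _ ≤ _ * R _ at h₂
        nlinarith [hR0 Fstar, hR0 F, mul_nonneg (show 0 ≤ D by
          obtain ⟨s⟩ := ‹Nonempty S›; linarith [haq s, hqb s]) (hR0 F)]
    · induction h : ℓ s with
      | bot => exact bot_le
      | top => exact absurd h (hl s)
      | coe r =>
        have h' := (hM s).2.2.2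
        have h'' := hq.2.1 s
        rw [h] at h' h''
        have := mul_le_mul_of_nonneg_left (EReal.coe_le_coe_iff.1 h'') (hw s).le
        rw [EReal.toReal_coe] at h'
        linarith [hqb s]
    · induction h : u s with
      | bot => exact absurd h (hu s)
      | top => exact le_top
      | coe r =>
        have h' := (hM s).2.2.1
        rw [h, EReal.toReal_coe] at h'
        exact EReal.coe_le_coe_iff.2 (hcancel s ((hbd s).2.trans h'))
    · rw [hspa]
      refine (spa_le (a := a + (-M - b)) (b := -M) (fun s => ?_) fun s => (hbd s).2).trans
        (by linarith)
      rw [hmul]; linarith [haq s]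
  · exact ⟨q, hq, fun s => abs_le.2 ⟨by linarith [haq s], by linarith [hqb s]⟩, le_rfl⟩

lemma exists_isOptimal [Fintype S] [Nonempty S] (𝓕 : Finset (Finset S)) (Fstar : Finset S)
    (c w : S → ℝ) (hw : ∀ s, 0 < w s) (ℓ u : S → EReal) (hl : ∀ s, ℓ s ≠ ⊤) (hu : ∀ s, u s ≠ ⊥)
    (hex : ∃ p : S → ℝ, IsFeasible 𝓕 Fstar c ℓ u p) :
    ∃ p, IsOptimal 𝓕 Fstar c ℓ u w p := by
  obtain ⟨p₀, hp₀⟩ := hex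
  obtain ⟨M, hM⟩ := exists_isFeasible_bounded 𝓕 Fstar c w hw ℓ u hl hu (spa w p₀)
  have hbox : IsCompact (Set.univ.pi fun s => Set.Icc (-M / w s) (M / w s)) :=
    isCompact_univ_pi fun _ => isCompact_Icc
  have hK := hbox.inter_left (isClosed_setOf_isFeasible 𝓕 Fstar c ℓ u)
  have hmem {q : S → ℝ} (hq : ∀ s, |w s * q s| ≤ M) :
      q ∈ Set.univ.pi fun s => Set.Icc (-M / w s) (M / w s) := fun s _ =>
    ⟨(div_le_iff₀' (hw s)).2 (abs_le.1 (hq s)).1, (le_div_iff₀' (hw s)).2 (abs_le.1 (hq s)).2⟩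
  obtain ⟨p₁, hp₁, hp₁M, hp₁p₀⟩ := hM p₀ hp₀ le_rfl
  obtain ⟨p, hp, hmin⟩ := hK.exists_isMinOn ⟨p₁, hp₁, hmem hp₁M⟩ (continuous_spa w).continuousOn
  refine ⟨p, hp.1, fun q hq => ?_⟩
  rcases le_total (spa w q) (spa w p₀) with h | h
  · obtain ⟨q', hq', hq'M, hq'q⟩ := hM q hq h
    exact (hmin ⟨hq', hmem hq'M⟩).trans hq'q
  · exact ((hmin ⟨hp₁, hmem hp₁M⟩).trans hp₁p₀).trans h

/-- If a feasible deviation vector exists, then there exist `δ, Δ ∈ ℝ` such that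
`p^{δ,Δ}_{ℓ,u,w}` is optimal with `min_{s∈S} w(s)p^{δ,Δ}(s) = Δ`,
`max_{s∈S} w(s)p^{δ,Δ}(s) = δ + Δ`; moreover `Δ ≤ w(s)u(s)` and
`δ + Δ ≥ w(s)ℓ(s)` for every `s ∈ S` (inequalities in `ℝ ∪ {±∞}`). -/
theorem stmt2 [Fintype S] [DecidableEq S] [Nonempty S]
    (𝓕 : Finset (Finset S)) (Fstar : Finset S) (hFstar : Fstar ∈ 𝓕)
    (c w : S → ℝ) (hw : ∀ s, 0 < w s)
    (ℓ u : S → EReal) (hl : ∀ s, ℓ s ≠ ⊤) (hu : ∀ s, u s ≠ ⊥)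
    (hlu : ∀ s, ℓ s ≤ u s)
    (hex : ∃ p : S → ℝ, IsFeasible 𝓕 Fstar c ℓ u p) :
    ∃ δ Δ : ℝ,
      IsOptimal 𝓕 Fstar c ℓ u w (pdd Fstar w ℓ u δ Δ) ∧
      (univ.inf' univ_nonempty fun s => w s * pdd Fstar w ℓ u δ Δ s) = Δ ∧
      (univ.sup' univ_nonempty fun s => w s * pdd Fstar w ℓ u δ Δ s) = δ + Δ ∧
      (∀ s, (Δ : EReal) ≤ (w s : EReal) * u s) ∧
      (∀ s, (w s : EReal) * ℓ s ≤ ((δ + Δ : ℝ) : EReal)) := by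
  obtain ⟨q, hq, hopt⟩ := exists_isOptimal 𝓕 Fstar c w hw ℓ u hl hu hex
  set a := univ.inf' univ_nonempty fun s => w s * q s
  set b := univ.sup' univ_nonempty fun s => w s * q s
  have hspa : spa w q = b - a := rfl
  have haq (s : S) : a ≤ w s * q s := Finset.inf'_le _ (Finset.mem_univ s)
  have hqb (s : S) : w s * q s ≤ b := Finset.le_sup' (fun s => w s * q s) (Finset.mem_univ s)
  have hab : a ≤ b := by
    obtain ⟨s⟩ := ‹Nonempty S›
    exact (haq s).trans (hqb s)
  have hba : b - a + a = b := sub_add_cancel b a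
  have key (s : S) := truncation_bounds (hw s) (haq s) (hqb s) (hq.2.1 s) (hq.2.2 s)
    (x := if s ∈ Fstar then b else a) (ite_div _ _ _ _).symm (by split_ifs <;> simp [hab])
    (by split_ifs <;> simp [hab]) (pdd Fstar w ℓ u (b - a) a s) (by simp only [pdd, hba])
  refine ⟨b - a, a, ?_⟩
  set p := pdd Fstar w ℓ u (b - a) a
  have hfeas : IsFeasible 𝓕 Fstar c ℓ u p := by
    refine ⟨fun F hF => costSum_le_of_monotone (fun s hs => ?_) (fun s hs => ?_) (hq.1 F hF),
      fun s => (key s).1, fun s => (key s).2.1⟩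
    · exact (key s).2.2.2.2.1 (by simp [hs])
    · exact (key s).2.2.2.2.2 (by simp [hs])
  have hle : spa w p ≤ spa w q :=
    spa_le (fun s => (key s).2.2.1) fun s => (key s).2.2.2.1
  have hge := hopt p hfeas
  have hinf : a ≤ univ.inf' univ_nonempty fun s => w s * p s :=
    Finset.le_inf' _ _ fun s _ => (key s).2.2.1
  have hsup : (univ.sup' univ_nonempty fun s => w s * p s) ≤ b :=
    Finset.sup'_le _ _ fun s _ => (key s).2.2.2.1
  rw [hspa, spa] at hge
  refine ⟨⟨hfeas, fun r hr => hle.trans (hopt r hr)⟩, by linarith, by linarith, fun s => ?_,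
    fun s => ?_⟩
  · calc (a : EReal) ≤ ((w s * q s : ℝ) : EReal) := EReal.coe_le_coe_iff.2 (haq s)
      _ = (w s : EReal) * (q s : EReal) := EReal.coe_mul _ _
      _ ≤ (w s : EReal) * u s :=
        mul_le_mul_of_nonneg_left (hq.2.2 s) (EReal.coe_nonneg.2 (hw s).le)
  · rw [hba]
    calc (w s : EReal) * ℓ s ≤ (w s : EReal) * (q s : EReal) :=
        mul_le_mul_of_nonneg_left (hq.2.1 s) (EReal.coe_nonneg.2 (hw s).le)
      _ = ((w s * q s : ℝ) : EReal) := (EReal.coe_mul _ _).symm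
      _ ≤ (b : EReal) := EReal.coe_le_coe_iff.2 (hqb s)
end
end

section
/- Assume ℓ and u satisfy (SPEC-LU) with u^in ∈ ℝ and ℓ^out ∈ ℝ. Then a feasible deviation vector exists if and only if p^{u^in − ℓ^out, ℓ^out}_{ℓ,u,w} is a feasible deviation vector. -/
open Finset

noncomputable section

variable {S : Type*}

/-- `μ(X) = ∑_{s ∈ X ∖ S₀} 1/w(s)`. -/
def muS [DecidableEq S] (w : S → ℝ) (S0 : Finset S) (X : Finset S) : ℝ :=
  ∑ s ∈ X \ S0, 1 / w s

/-- The bound functions `ℓ, u` satisfy (SPEC-LU) with data `S₀, ℓ^in, ℓ^out, u^in, u^out`: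
`ℓ(s) = u(s) = 0` on `S₀`; `w(s)ℓ(s) = ℓ^in`, `w(s)u(s) = u^in` on `F* ∖ S₀`;
`w(s)ℓ(s) = ℓ^out`, `w(s)u(s) = u^out` outside `F* ∪ S₀`; together with the
ordering conditions of the paper. (`ℓ^in, ℓ^out ∈ ℝ ∪ {−∞}` and
`u^in, u^out ∈ ℝ ∪ {+∞}`.) -/
def SpecLU [DecidableEq S] (Fstar : Finset S) (w : S → ℝ) (ℓ u : S → EReal)
    (S0 : Finset S) (lin lout uin uout : EReal) : Prop :=
  (∀ s ∈ S0, ℓ s = 0 ∧ u s = 0) ∧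
  (∀ s ∈ Fstar, s ∉ S0 → (w s : EReal) * ℓ s = lin ∧ (w s : EReal) * u s = uin) ∧
  (∀ s, s ∉ Fstar → s ∉ S0 → (w s : EReal) * ℓ s = lout ∧ (w s : EReal) * u s = uout) ∧
  lin ≤ uin ∧ lout ≤ uout ∧
  ((S0 ∩ Fstar).Nonempty → 0 ≤ lin) ∧
  ((S0 \ Fstar).Nonempty → uout ≤ 0) ∧
  (∀ s ∉ Fstar, ∀ t ∈ Fstar,
      (w s : EReal) * lout ≤ (w t : EReal) * lin ∧
      (w s : EReal) * uout ≤ (w t : EReal) * uin) ∧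
  lin ≠ ⊤ ∧ lout ≠ ⊤ ∧ uin ≠ ⊥ ∧ uout ≠ ⊥

/-- A real equation `r * x = a` with `r > 0` determines the extended real `x`. -/
theorem EReal.eq_coe_div_of_coe_mul_eq {r a : ℝ} {x : EReal} (hr : 0 < r)
    (h : (r : EReal) * x = (a : EReal)) : x = ((a / r : ℝ) : EReal) := by
  induction x with
  | bot => simp [EReal.coe_mul_bot_of_pos hr] at h
  | top => simp [EReal.coe_mul_top_of_pos hr] at h
  | coe y =>
    norm_cast at h ⊢
    rw [← h]
    field_simp

/-- If `q` is at least `p` on `X` and at most `p` outside `X`, then passing from `p` to `q`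
preserves that `X` is no more expensive than `Y`. -/
theorem costSum_sub_le_of_le [DecidableEq S] {c p q : S → ℝ} {X Y : Finset S}
    (hin : ∀ s ∈ X, p s ≤ q s) (hout : ∀ s, s ∉ X → q s ≤ p s)
    (h : costSum (fun s => c s - p s) X ≤ costSum (fun s => c s - p s) Y) :
    costSum (fun s => c s - q s) X ≤ costSum (fun s => c s - q s) Y := by
  unfold costSum at *
  rw [← sum_sdiff_le_sum_sdiff] at h ⊢
  calc ∑ s ∈ X \ Y, (c s - q s) ≤ ∑ s ∈ X \ Y, (c s - p s) :=
        sum_le_sum fun s hs => sub_le_sub_left (hin s (mem_sdiff.1 hs).1) _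
    _ ≤ ∑ s ∈ Y \ X, (c s - p s) := h
    _ ≤ ∑ s ∈ Y \ X, (c s - q s) :=
        sum_le_sum fun s hs => sub_le_sub_left (hout s (mem_sdiff.1 hs).2) _

/-- Where both bounds vanish, the truncated deviation vector vanishes. -/
theorem pdd_eq_zero [DecidableEq S] {Fstar : Finset S} {w : S → ℝ} {ℓ u : S → EReal}
    {δ Δ : ℝ} {s : S} (hl : ℓ s = 0) (hu : u s = 0) : pdd Fstar w ℓ u δ Δ s = 0 := by
  simp only [pdd, hl, hu, EReal.toReal_zero]
  split_ifs with h1 h2 h3 h4 h5 <;> norm_cast at * <;> linarith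

/-- Under the special bounds, `p^{u^in − ℓ^out, ℓ^out}` agrees with `u` on `F*`. -/
theorem SpecLU.coe_pdd_of_mem [DecidableEq S] {Fstar S0 : Finset S} {w : S → ℝ}
    {ℓ u : S → EReal} {lin uout : EReal} {uin lout : ℝ} (hw : ∀ s, 0 < w s)
    (hlu : ∀ s, ℓ s ≤ u s) (hspec : SpecLU Fstar w ℓ u S0 lin lout uin uout)
    {s : S} (hs : s ∈ Fstar) :
    ((pdd Fstar w ℓ u (uin - lout) lout s : ℝ) : EReal) = u s := by
  by_cases h0 : s ∈ S0
  · obtain ⟨hl, hu⟩ := hspec.1 s h0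
    rw [pdd_eq_zero hl hu, hu, EReal.coe_zero]
  · have hu := EReal.eq_coe_div_of_coe_mul_eq (hw s) (hspec.2.1 s hs h0).2
    have hl := hlu s
    rw [hu] at hl
    simp [pdd, hs, hu, not_lt.2 hl]

/-- Under the special bounds, `p^{u^in − ℓ^out, ℓ^out}` agrees with `ℓ` outside `F*`. -/
theorem SpecLU.coe_pdd_of_notMem [DecidableEq S] {Fstar S0 : Finset S} {w : S → ℝ}
    {ℓ u : S → EReal} {lin uout : EReal} {uin lout : ℝ} (hw : ∀ s, 0 < w s)
    (hlu : ∀ s, ℓ s ≤ u s) (hspec : SpecLU Fstar w ℓ u S0 lin lout uin uout)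
    {s : S} (hs : s ∉ Fstar) :
    ((pdd Fstar w ℓ u (uin - lout) lout s : ℝ) : EReal) = ℓ s := by
  by_cases h0 : s ∈ S0
  · obtain ⟨hl, hu⟩ := hspec.1 s h0
    rw [pdd_eq_zero hl hu, hl, EReal.coe_zero]
  · have hl := EReal.eq_coe_div_of_coe_mul_eq (hw s) (hspec.2.2.1 s hs h0).1
    have hu := hlu s
    rw [hl] at hu
    simp [pdd, hs, hl, not_lt.2 hu]

/-- If `ℓ, u` satisfy (SPEC-LU) with `u^in ∈ ℝ` and `ℓ^out ∈ ℝ`, then a feasible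
deviation vector exists iff `p^{u^in − ℓ^out, ℓ^out}_{ℓ,u,w}` is feasible. -/
theorem stmt3 [Fintype S] [DecidableEq S] [Nonempty S]
    (𝓕 : Finset (Finset S)) (Fstar : Finset S) (hFstar : Fstar ∈ 𝓕)
    (c w : S → ℝ) (hw : ∀ s, 0 < w s)
    (ℓ u : S → EReal) (hlu : ∀ s, ℓ s ≤ u s)
    (S0 : Finset S) (lin uout : EReal) (uin lout : ℝ)
    (hspec : SpecLU Fstar w ℓ u S0 lin (lout : EReal) (uin : EReal) uout) :
    (∃ p : S → ℝ, IsFeasible 𝓕 Fstar c ℓ u p) ↔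
      IsFeasible 𝓕 Fstar c ℓ u (pdd Fstar w ℓ u (uin - lout) lout) := by
  refine ⟨fun ⟨p, hmin, hl, hu⟩ => ?_, fun h => ⟨_, h⟩⟩
  have hin := fun s (hs : s ∈ Fstar) => hspec.coe_pdd_of_mem hw hlu hs
  have hout := fun s (hs : s ∉ Fstar) => hspec.coe_pdd_of_notMem hw hlu hs
  refine ⟨fun F hF => costSum_sub_le_of_le (fun s hs => ?_) (fun s hs => ?_) (hmin F hF),
    fun s => ?_, fun s => ?_⟩
  · exact EReal.coe_le_coe_iff.1 ((hu s).trans_eq (hin s hs).symm)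
  · exact EReal.coe_le_coe_iff.1 ((hout s hs).trans_le (hl s))
  · by_cases hs : s ∈ Fstar
    · exact (hlu s).trans_eq (hin s hs).symm
    · exact (hout s hs).ge
  · by_cases hs : s ∈ Fstar
    · exact (hin s hs).le
    · exact (hout s hs).trans_le (hlu s)
end
end

section
/- For every feasible deviation vector p, every j ∈ {1,…,k}, and every F'' ∈ 𝓕 with F'' ≠ F* and (1/w)(F'') = (1/w)(F*), one has spa_w(p) ≥ (c^j(F*) − c^j(F''))/(1/w)(F* ∖ F''). -/
open Finset

noncomputable section

variable {S : Type*}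

/-- `(1/w)(X) = ∑_{s∈X} 1/w(s)`. -/
def invw (w : S → ℝ) (X : Finset S) : ℝ := ∑ s ∈ X, 1 / w s

/-- A deviation vector `p` is feasible (no bound constraints) for the cost
functions `c^1, …, c^k` if `F*` has minimum `(c^j − p)`-cost in `𝓕` for all `j`. -/
def FeasibleU (𝓕 : Finset (Finset S)) (Fstar : Finset S) {k : ℕ}
    (c : Fin k → S → ℝ) (p : S → ℝ) : Prop :=
  ∀ j : Fin k, ∀ F ∈ 𝓕,
    costSum (fun s => c j s - p s) Fstar ≤ costSum (fun s => c j s - p s) F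

theorem spa_nonneg [Fintype S] [Nonempty S] (w p : S → ℝ) : 0 ≤ spa w p := by
  obtain ⟨s⟩ := ‹Nonempty S›
  exact sub_nonneg.mpr ((inf'_le (fun s => w s * p s) (mem_univ s)).trans
    (le_sup' (fun s => w s * p s) (mem_univ s)))

theorem costSum_le_sup_mul_invw [Fintype S] [Nonempty S] {w : S → ℝ} (hw : ∀ s, 0 < w s)
    (p : S → ℝ) (X : Finset S) :
    costSum p X ≤ (univ.sup' univ_nonempty fun s => w s * p s) * invw w X := by
  rw [costSum, invw, mul_sum]
  refine sum_le_sum fun s _ => ?_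
  rw [mul_one_div, le_div_iff₀ (hw s), mul_comm]
  exact le_sup' (fun s => w s * p s) (mem_univ s)

theorem inf_mul_invw_le_costSum [Fintype S] [Nonempty S] {w : S → ℝ} (hw : ∀ s, 0 < w s)
    (p : S → ℝ) (X : Finset S) :
    (univ.inf' univ_nonempty fun s => w s * p s) * invw w X ≤ costSum p X := by
  rw [costSum, invw, mul_sum]
  refine sum_le_sum fun s _ => ?_
  rw [mul_one_div, div_le_iff₀ (hw s), mul_comm (p s)]
  exact inf'_le (fun s => w s * p s) (mem_univ s)

/-- For every feasible deviation vector `p`, every `j`, and every `F'' ∈ 𝓕` with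
`F'' ≠ F*` and `(1/w)(F'') = (1/w)(F*)`, one has
`spa_w(p) ≥ (c^j(F*) − c^j(F'')) / (1/w)(F* ∖ F'')`. -/
theorem stmt9 [Fintype S] [DecidableEq S] [Nonempty S]
    (𝓕 : Finset (Finset S)) (Fstar : Finset S) (hFstar : Fstar ∈ 𝓕)
    (k : ℕ) (hk : 1 ≤ k) (c : Fin k → S → ℝ)
    (w : S → ℝ) (hw : ∀ s, 0 < w s)
    (p : S → ℝ) (hp : FeasibleU 𝓕 Fstar c p)
    (j : Fin k) (F'' : Finset S) (hF'' : F'' ∈ 𝓕) (hne : F'' ≠ Fstar)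
    (hsize : invw w F'' = invw w Fstar) :
    (costSum (c j) Fstar - costSum (c j) F'') / invw w (Fstar \ F'') ≤ spa w p := by
  have hspa := spa_nonneg w p
  refine div_le_of_le_mul₀ (sum_nonneg fun s _ => (one_div_pos.mpr (hw s)).le) hspa ?_
  have hfeas := hp j F'' hF''
  simp only [costSum, sum_sub_distrib] at hfeas ⊢
  have hp_diff := sum_sdiff_sub_sum_sdiff (s₁ := F'') (s₂ := Fstar) (f := p)
  have hw_diff := sum_sdiff_sub_sum_sdiff (s₁ := F'') (s₂ := Fstar) (f := fun s => 1 / w s)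
  have hupper := costSum_le_sup_mul_invw hw p (Fstar \ F'')
  have hlower := inf_mul_invw_le_costSum hw p (F'' \ Fstar)
  have hsdiff : invw w (F'' \ Fstar) = invw w (Fstar \ F'') := by
    unfold invw at hsize ⊢
    linarith
  rw [hsdiff] at hlower
  unfold costSum at hupper hlower
  rw [spa, sub_mul]
  linarith
end
end

section
/- Let d := max A, where A is the finite set of real numbers consisting of 0, together with all values (c^j(F*) − c^j(F''))/(1/w)(F* ∖ F'') where j ∈ {1,…,k} and F'' ∈ 𝓕 satisfies F'' ≠ F* and (1/w)(F'') = (1/w)(F*), and together with all values [ (c^{j1}(F*) − c^{j1}(F'))/((1/w)(F*) − (1/w)(F')) − (c^{j2}(F*) − c^{j2}(F'''))/((1/w)(F*) − (1/w)(F''')) ] / [ (1/w)(F* ∖ F')/((1/w)(F*) − (1/w)(F')) − (1/w)(F* ∖ F''')/((1/w)(F*) − (1/w)(F''')) ] where j1, j2 ∈ {1,…,k} and F', F''' ∈ 𝓕 satisfy (1/w)(F') < (1/w)(F*) < (1/w)(F'''). Then there exists Δ ∈ ℝ such that p^{d,Δ}_w is a feasible deviation vector; in particular spa_w(p^{d,Δ}_w)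 ≤ d. -/
open Finset

noncomputable section

variable {S : Type*}

/-- The untruncated deviation vector `p^{δ,Δ}_w`: value `(δ+Δ)/w(s)` on `F*`
and `Δ/w(s)` outside `F*`. -/
def pddU [DecidableEq S] (Fstar : Finset S) (w : S → ℝ) (δ Δ : ℝ) (s : S) : ℝ :=
  if s ∈ Fstar then (δ + Δ) / w s else Δ / w s

/-- Finitely many lower bounds, each at most each of finitely many upper bounds, leave a common
point. -/
theorem exists_between_of_finset_le (L U : Finset ℝ) (h : ∀ l ∈ L, ∀ u ∈ U, l ≤ u) :
    ∃ x, (∀ l ∈ L, l ≤ x) ∧ ∀ u ∈ U, x ≤ u := by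
  rcases L.eq_empty_or_nonempty with rfl | hL
  · rcases U.eq_empty_or_nonempty with rfl | hU
    · exact ⟨0, by simp, by simp⟩
    · exact ⟨U.min' hU, by simp, fun u hu => U.min'_le u hu⟩
  · exact ⟨L.max' hL, fun l hl => L.le_max' l hl, fun u hu => h _ (L.max'_mem hL) u hu⟩

theorem invw_nonneg (w : S → ℝ) (hw : ∀ s, 0 < w s) (X : Finset S) : 0 ≤ invw w X :=
  sum_nonneg fun s _ => (one_div_pos.2 (hw s)).le

theorem invw_pos_iff (w : S → ℝ) (hw : ∀ s, 0 < w s) (X : Finset S) :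
    0 < invw w X ↔ X.Nonempty := by
  refine ⟨fun h => ?_, fun h => sum_pos (fun s _ => one_div_pos.2 (hw s)) h⟩
  by_contra hX
  simp [invw, not_nonempty_iff_eq_empty.1 hX] at h

theorem invw_sub_invw [DecidableEq S] (w : S → ℝ) (X Y : Finset S) :
    invw w X - invw w Y = invw w (X \ Y) - invw w (Y \ X) := by
  simpa only [invw] using (sum_sdiff_sub_sum_sdiff (f := fun s => 1 / w s)).symm

theorem invw_sdiff_pos_of_invw_eq [DecidableEq S] (w : S → ℝ) (hw : ∀ s, 0 < w s)
    {X Y : Finset S} (hne : Y ≠ X) (h : invw w Y = invw w X) : 0 < invw w (X \ Y) := by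
  have hsub := invw_sub_invw w X Y
  by_contra hX
  have hY : ¬ 0 < invw w (Y \ X) := by linarith
  rw [invw_pos_iff w hw, not_nonempty_iff_eq_empty, sdiff_eq_empty_iff_subset] at hX hY
  exact hne (hY.antisymm hX)

theorem costSum_pddU_sub [DecidableEq S] (Fstar F : Finset S) (w : S → ℝ) (δ Δ : ℝ) :
    costSum (pddU Fstar w δ Δ) Fstar - costSum (pddU Fstar w δ Δ) F =
      δ * invw w (Fstar \ F) + Δ * (invw w Fstar - invw w F) := by
  have hin : costSum (pddU Fstar w δ Δ) (Fstar \ F) = (δ + Δ) * invw w (Fstar \ F) := by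
    rw [costSum, invw, mul_sum]
    refine sum_congr rfl fun s hs => ?_
    rw [pddU, if_pos (mem_sdiff.1 hs).1, mul_one_div]
  have hout : costSum (pddU Fstar w δ Δ) (F \ Fstar) = Δ * invw w (F \ Fstar) := by
    rw [costSum, invw, mul_sum]
    refine sum_congr rfl fun s hs => ?_
    rw [pddU, if_neg (mem_sdiff.1 hs).2, mul_one_div]
  have hsub : costSum (pddU Fstar w δ Δ) Fstar - costSum (pddU Fstar w δ Δ) F =
      costSum (pddU Fstar w δ Δ) (Fstar \ F) - costSum (pddU Fstar w δ Δ) (F \ Fstar) := by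
    simp only [costSum]
    exact sum_sdiff_sub_sum_sdiff.symm
  rw [hsub, hin, hout, invw_sub_invw]
  ring

theorem feasibleU_pddU_iff [DecidableEq S] (𝓕 : Finset (Finset S)) (Fstar : Finset S) {k : ℕ}
    (c : Fin k → S → ℝ) (w : S → ℝ) (δ Δ : ℝ) :
    FeasibleU 𝓕 Fstar c (pddU Fstar w δ Δ) ↔ ∀ j : Fin k, ∀ F ∈ 𝓕,
      costSum (c j) Fstar - costSum (c j) F ≤
        δ * invw w (Fstar \ F) + Δ * (invw w Fstar - invw w F) := by
  refine forall_congr' fun j => forall₂_congr fun F _ => ?_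
  rw [← costSum_pddU_sub]
  simp only [costSum, sum_sub_distrib]
  constructor <;> intro h <;> linarith

theorem spa_pddU_le [Fintype S] [DecidableEq S] [Nonempty S] (Fstar : Finset S) (w : S → ℝ)
    (hw : ∀ s, 0 < w s) {δ : ℝ} (hδ : 0 ≤ δ) (Δ : ℝ) : spa w (pddU Fstar w δ Δ) ≤ δ := by
  have hval (s : S) : Δ ≤ w s * pddU Fstar w δ Δ s ∧ w s * pddU Fstar w δ Δ s ≤ δ + Δ := by
    rw [pddU]
    split_ifs
    · rw [mul_div_cancel₀ _ (hw s).ne']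
      constructor <;> linarith
    · rw [mul_div_cancel₀ _ (hw s).ne']
      constructor <;> linarith
  have hsup : (univ.sup' univ_nonempty fun s => w s * pddU Fstar w δ Δ s) ≤ δ + Δ :=
    sup'_le _ _ fun s _ => (hval s).2
  have hinf : Δ ≤ univ.inf' univ_nonempty fun s => w s * pddU Fstar w δ Δ s :=
    le_inf' _ _ fun s _ => (hval s).1
  rw [spa]
  linarith

/-- If `d = max A`, where `A` is the finite set of candidate values from the
min–max theorem, then there exists `Δ ∈ ℝ` such that `p^{d,Δ}_w` is a feasible
deviation vector; in particular `spa_w(p^{d,Δ}_w) ≤ d`. -/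
theorem stmt11 [Fintype S] [DecidableEq S] [Nonempty S]
    (𝓕 : Finset (Finset S)) (Fstar : Finset S) (hFstar : Fstar ∈ 𝓕)
    (k : ℕ) (hk : 1 ≤ k) (c : Fin k → S → ℝ)
    (w : S → ℝ) (hw : ∀ s, 0 < w s)
    (A : Set ℝ)
    (hA : A = {0} ∪
        {x | ∃ j : Fin k, ∃ F'' ∈ 𝓕, F'' ≠ Fstar ∧ invw w F'' = invw w Fstar ∧
          x = (costSum (c j) Fstar - costSum (c j) F'') / invw w (Fstar \ F'')} ∪
        {x | ∃ j1 j2 : Fin k, ∃ F' ∈ 𝓕, ∃ F''' ∈ 𝓕,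
          invw w F' < invw w Fstar ∧ invw w Fstar < invw w F''' ∧
          x = ((costSum (c j1) Fstar - costSum (c j1) F') /
                  (invw w Fstar - invw w F') -
               (costSum (c j2) Fstar - costSum (c j2) F''') /
                  (invw w Fstar - invw w F''')) /
              (invw w (Fstar \ F') / (invw w Fstar - invw w F') -
               invw w (Fstar \ F''') / (invw w Fstar - invw w F'''))})
    (d : ℝ) (hd : IsGreatest A d) :
    ∃ Δ : ℝ, FeasibleU 𝓕 Fstar c (pddU Fstar w d Δ) ∧
      spa w (pddU Fstar w d Δ) ≤ d := by
  subst hA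
  have hd0 : 0 ≤ d := hd.2 (Or.inl (Or.inl rfl))
  let b : Fin k × Finset S → ℝ := fun q =>
    (costSum (c q.1) Fstar - costSum (c q.1) q.2 - d * invw w (Fstar \ q.2)) /
      (invw w Fstar - invw w q.2)
  obtain ⟨Δ, hL, hU⟩ := exists_between_of_finset_le
    (((univ ×ˢ 𝓕).filter fun q => invw w q.2 < invw w Fstar).image b)
    (((univ ×ˢ 𝓕).filter fun q => invw w Fstar < invw w q.2).image b) (by
      simp only [mem_image, mem_filter, mem_product, mem_univ, true_and]
      rintro _ ⟨⟨j₁, F₁⟩, ⟨hF₁, hlt₁⟩, rfl⟩ _ ⟨⟨j₂, F₂⟩, ⟨hF₂, hlt₂⟩, rfl⟩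
      dsimp only at hF₁ hlt₁ hF₂ hlt₂
      have hle := hd.2 (Or.inr ⟨j₁, j₂, F₁, hF₁, F₂, hF₂, hlt₁, hlt₂, rfl⟩)
      have hpos : 0 < invw w (Fstar \ F₁) / (invw w Fstar - invw w F₁) :=
        div_pos (by linarith [invw_sub_invw w Fstar F₁, invw_nonneg w hw (F₁ \ Fstar)])
          (sub_pos.2 hlt₁)
      have hnonpos : invw w (Fstar \ F₂) / (invw w Fstar - invw w F₂) ≤ 0 :=
        div_nonpos_of_nonneg_of_nonpos (invw_nonneg w hw _) (sub_neg.2 hlt₂).le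
      rw [div_le_iff₀ (by linarith)] at hle
      simp only [b, sub_div _ (d * _), mul_div_assoc]
      linarith)
  refine ⟨Δ, (feasibleU_pddU_iff 𝓕 Fstar c w d Δ).2 fun j F hF => ?_, spa_pddU_le Fstar w hw hd0 Δ⟩
  rcases lt_trichotomy (invw w F) (invw w Fstar) with hlt | heq | hgt
  · have h : b (j, F) ≤ Δ := hL _ (mem_image_of_mem b (by simp [hF, hlt]))
    rw [div_le_iff₀ (sub_pos.2 hlt)] at h
    linarith
  · by_cases hne : F = Fstar
    · simp [hne, invw]
    · have h := hd.2 (Or.inl (Or.inr ⟨j, F, hF, hne, heq, rfl⟩))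
      rw [div_le_iff₀ (invw_sdiff_pos_of_invw_eq w hw hne heq)] at h
      rw [heq]
      linarith
  · have h : Δ ≤ b (j, F) := hU _ (mem_image_of_mem b (by simp [hF, hgt]))
    rw [le_div_iff_of_neg (sub_neg.2 hgt)] at h
    linarith
end
end
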